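/- arXiv:2207.01140 — 3 statements merged into one kernel-verified Lean document; each statement's English description precedes it below -/
import Mathlib

section
/- The isomorphic Hamming distance is a pseudometric on approval elections with a fixed number m of candidates and n of voters: for all such elections E, F, G one has d_ham(E,E) = 0, d_ham(E,F) = d_ham(F,E), and d_ham(E,G) ≤ d_ham(E,F) + d_ham(F,G). -/
/-- An approval election with `m` candidates and `n` voters: each voter is identified
with its approval ballot, a subset of the candidate set `Fin m`. -/
def dham {m n : ℕ} (E F : Fin n → Finset (Fin m)) : ℕ :=
  Finset.univ.inf' ⟨(1, 1), Finset.mem_univ _⟩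
    (fun σρ : Equiv.Perm (Fin m) × Equiv.Perm (Fin n) =>
      ∑ i, (symmDiff ((E i).image σρ.1) (F (σρ.2 i))).card)

/-- The cost of matching candidates by `σ` and voters by `ρ`. -/
def hammingCost {m n : ℕ} (E F : Fin n → Finset (Fin m))
    (σ : Equiv.Perm (Fin m)) (ρ : Equiv.Perm (Fin n)) : ℕ :=
  ∑ i, (symmDiff ((E i).image σ) (F (ρ i))).card

theorem dham_le_hammingCost {m n : ℕ} (E F : Fin n → Finset (Fin m))
    (σ : Equiv.Perm (Fin m)) (ρ : Equiv.Perm (Fin n)) :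
    dham E F ≤ hammingCost E F σ ρ :=
  Finset.inf'_le (fun σρ : Equiv.Perm (Fin m) × Equiv.Perm (Fin n) =>
    hammingCost E F σρ.1 σρ.2) (Finset.mem_univ (σ, ρ))

theorem exists_dham_eq_hammingCost {m n : ℕ} (E F : Fin n → Finset (Fin m)) :
    ∃ σ ρ, dham E F = hammingCost E F σ ρ := by
  obtain ⟨⟨σ, ρ⟩, -, h⟩ := Finset.exists_mem_eq_inf' ⟨(1, 1), Finset.mem_univ _⟩
    (fun σρ : Equiv.Perm (Fin m) × Equiv.Perm (Fin n) => hammingCost E F σρ.1 σρ.2)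
  exact ⟨σ, ρ, h⟩

theorem hammingCost_one_one {m n : ℕ} (E : Fin n → Finset (Fin m)) :
    hammingCost E E 1 1 = 0 := by
  simp [hammingCost]

theorem card_symmDiff_image_perm {α : Type*} [DecidableEq α] (A B : Finset α)
    (σ : Equiv.Perm α) :
    (symmDiff (A.image σ) (B.image σ)).card = (symmDiff A B).card := by
  rw [← Finset.image_symmDiff A B σ.injective, Finset.card_image_of_injective _ σ.injective]

theorem hammingCost_inv {m n : ℕ} (E F : Fin n → Finset (Fin m))
    (σ : Equiv.Perm (Fin m)) (ρ : Equiv.Perm (Fin n)) :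
    hammingCost F E σ⁻¹ ρ⁻¹ = hammingCost E F σ ρ := by
  unfold hammingCost
  rw [← Equiv.sum_comp ρ]
  refine Finset.sum_congr rfl fun i _ => ?_
  rw [← card_symmDiff_image_perm _ _ σ, Finset.image_image, symmDiff_comm]
  simp [Function.comp_def]

theorem card_symmDiff_triangle {α : Type*} [DecidableEq α] (A B C : Finset α) :
    (symmDiff A C).card ≤ (symmDiff A B).card + (symmDiff B C).card :=
  (Finset.card_le_card (symmDiff_triangle A B C)).trans (Finset.card_union_le _ _)

theorem hammingCost_mul_le {m n : ℕ} (E F G : Fin n → Finset (Fin m))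
    (σ τ : Equiv.Perm (Fin m)) (ρ π : Equiv.Perm (Fin n)) :
    hammingCost E G (τ * σ) (π * ρ) ≤ hammingCost E F σ ρ + hammingCost F G τ π := by
  unfold hammingCost
  rw [← Equiv.sum_comp ρ (fun i => (symmDiff ((F i).image τ) (G (π i))).card),
    ← Finset.sum_add_distrib]
  refine Finset.sum_le_sum fun i _ => ?_
  rw [← card_symmDiff_image_perm _ (F (ρ i)) τ, Finset.image_image]
  exact card_symmDiff_triangle _ _ _

theorem dham_le_swap {m n : ℕ} (E F : Fin n → Finset (Fin m)) : dham F E ≤ dham E F := by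
  obtain ⟨σ, ρ, h⟩ := exists_dham_eq_hammingCost E F
  rw [h, ← hammingCost_inv]
  exact dham_le_hammingCost F E _ _

/-- The isomorphic Hamming distance is a pseudometric on approval
elections with a fixed number m of candidates and n of voters. -/
theorem dham_pseudometric (m n : ℕ) (E F G : Fin n → Finset (Fin m)) :
    dham E E = 0 ∧ dham E F = dham F E ∧ dham E G ≤ dham E F + dham F G := by
  refine ⟨?_, le_antisymm (dham_le_swap F E) (dham_le_swap E F), ?_⟩
  · exact Nat.le_zero.mp ((dham_le_hammingCost E E 1 1).trans_eq (hammingCost_one_one E))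
  · obtain ⟨σ, ρ, h₁⟩ := exists_dham_eq_hammingCost E F
    obtain ⟨τ, π, h₂⟩ := exists_dham_eq_hammingCost F G
    rw [h₁, h₂]
    exact (dham_le_hammingCost E G _ _).trans (hammingCost_mul_le E F G σ τ ρ π)
end

section
/- Let m ≥ 1, φ ∈ [0,1], and p, p' ∈ [0,1] be such that p·m and p'·m are integers. Then the approvalwise distance between av(p,φ) and av(p',φ) equals m·|p − p'|. -/
/-- The vector av(p,φ) ∈ ℝ^m: its first p·m coordinates (here k = p·m) equal
(1−φ) + φ·p and its remaining (1−p)·m coordinates equal φ·p. -/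
def avVec (m k : ℕ) (p φ : ℝ) : Fin m → ℝ :=
  fun i => if (i : ℕ) < k then (1 - φ) + φ * p else φ * p

/-- The approvalwise distance: the ℓ1 distance between two vectors in ℝ^m. -/
def dapp {m : ℕ} (x y : Fin m → ℝ) : ℝ := ∑ i, |x i - y i|

theorem dapp_comm {m : ℕ} (x y : Fin m → ℝ) : dapp x y = dapp y x :=
  Finset.sum_congr rfl fun i _ => abs_sub_comm (x i) (y i)

theorem dapp_of_le {m : ℕ} {x y : Fin m → ℝ} (h : y ≤ x) :
    dapp x y = ∑ i, x i - ∑ i, y i := by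
  rw [dapp, ← Finset.sum_sub_distrib]
  exact Finset.sum_congr rfl fun i _ => abs_of_nonneg (sub_nonneg.2 (h i))

theorem sum_avVec {m k : ℕ} (hkm : k ≤ m) (p φ : ℝ) :
    ∑ i, avVec m k p φ i = k * (1 - φ) + m * (φ * p) := by
  have h : ∀ i, avVec m k p φ i = (if (i : ℕ) < k then 1 - φ else 0) + φ * p := by
    intro i
    unfold avVec
    split_ifs <;> ring
  simp only [h, Finset.sum_add_distrib, Finset.sum_const, Finset.card_univ, Fintype.card_fin,
    nsmul_eq_mul, ← Finset.sum_filter, Fin.card_filter_val_lt, min_eq_right hkm]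

theorem avVec_mono {m k k' : ℕ} {p p' φ : ℝ} (hφ : φ ∈ Set.Icc (0 : ℝ) 1)
    (hk : k ≤ k') (hp : p ≤ p') : avVec m k p φ ≤ avVec m k' p' φ := by
  intro i
  have h := mul_le_mul_of_nonneg_left hp hφ.1
  have h1 := hφ.2
  unfold avVec
  split_ifs
  · linarith
  · omega
  · linarith
  · exact h

/-- For m ≥ 1, φ ∈ [0,1], and p, p' ∈ [0,1] with p·m and p'·m integers,
the approvalwise distance between av(p,φ) and av(p',φ) equals m·|p − p'|. -/
theorem dapp_avVec_same_phi (m k k' : ℕ) (hm : 1 ≤ m) (p p' φ : ℝ)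
    (hp : p ∈ Set.Icc (0 : ℝ) 1) (hp' : p' ∈ Set.Icc (0 : ℝ) 1)
    (hφ : φ ∈ Set.Icc (0 : ℝ) 1)
    (hk : (k : ℝ) = p * m) (hk' : (k' : ℝ) = p' * m) :
    dapp (avVec m k p φ) (avVec m k' p' φ) = m * |p - p'| := by
  wlog hle : p' ≤ p generalizing k k' p p'
  · rw [dapp_comm, abs_sub_comm]
    exact this k' k p' p hp' hp hk' hk (le_of_not_ge hle)
  have hm0 : (0 : ℝ) ≤ m := Nat.cast_nonneg m
  have hkk : k' ≤ k := (Nat.cast_le (α := ℝ)).1 (by rw [hk, hk']; gcongr)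
  have hkm : k ≤ m := (Nat.cast_le (α := ℝ)).1 (by rw [hk]; exact mul_le_of_le_one_left hm0 hp.2)
  rw [dapp_of_le (avVec_mono hφ hkk hle), sum_avVec hkm, sum_avVec (hkk.trans hkm), hk, hk',
    abs_of_nonneg (sub_nonneg.2 hle)]
  ring
end

section
/- Let m ≥ 1, p ∈ [0,1] with p·m an integer, and φ, φ' ∈ [0,1]. Then the approvalwise distance between av(p,φ) and av(p,φ') equals 2·m·p·(1−p)·|φ − φ'|. -/
theorem abs_avVec_sub_avVec (m k : ℕ) {p : ℝ} (hp : p ∈ Set.Icc (0 : ℝ) 1) (φ φ' : ℝ)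
    (i : Fin m) : |avVec m k p φ i - avVec m k p φ' i| =
      if (i : ℕ) < k then (1 - p) * |φ - φ'| else p * |φ - φ'| := by
  unfold avVec
  split_ifs
  · rw [show 1 - φ + φ * p - (1 - φ' + φ' * p) = (1 - p) * (φ' - φ) by ring, abs_mul,
      abs_of_nonneg (sub_nonneg.2 hp.2), abs_sub_comm]
  · rw [← sub_mul, abs_mul, abs_of_nonneg hp.1, mul_comm]

theorem sum_fin_ite_val_lt {m k : ℕ} (hkm : k ≤ m) (a b : ℝ) :
    ∑ i : Fin m, (if (i : ℕ) < k then a else b) = k * a + (m - k) * b := by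
  obtain ⟨n, rfl⟩ := Nat.exists_eq_add_of_le hkm
  simp [Fin.sum_univ_add]

/-- For m ≥ 1, p ∈ [0,1] with p·m an integer, and φ, φ' ∈ [0,1], the
approvalwise distance between av(p,φ) and av(p,φ') equals 2·m·p·(1−p)·|φ − φ'|. -/
theorem dapp_avVec_same_p (m k : ℕ) (hm : 1 ≤ m) (p φ φ' : ℝ)
    (hp : p ∈ Set.Icc (0 : ℝ) 1) (hφ : φ ∈ Set.Icc (0 : ℝ) 1)
    (hφ' : φ' ∈ Set.Icc (0 : ℝ) 1) (hk : (k : ℝ) = p * m) :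
    dapp (avVec m k p φ) (avVec m k p φ') = 2 * m * p * (1 - p) * |φ - φ'| := by
  have hkm : k ≤ m := by
    have h : (k : ℝ) ≤ m := hk ▸ mul_le_of_le_one_left m.cast_nonneg hp.2
    exact_mod_cast h
  simp only [dapp, abs_avVec_sub_avVec m k hp]
  rw [sum_fin_ite_val_lt hkm, hk]
  ring
end
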